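/- Real t-Jordan-type decomposition: every real tensor A ∈ ℝ^{n×n×p} admits a factorization A = P * J * P⁻¹, where P ∈ ℝ^{n×n×p} is t-invertible and J ∈ ℝ^{n×n×p} is f-upper-block-bi-diagonal: there is a partition n = n_1 + … + n_r with n_j ∈ {1,2} such that every frontal slice of J is block upper triangular with only the diagonal blocks and first superdiagonal blocks possibly nonzero. -/

import Mathlib

open Matrix Complex BigOperators Kronecker

/-- A third-order tensor, represented by its frontal slices (indexed cyclically). -/
abbrev Tensor (F : Type*) (m n p : ℕ) : Type _ :=
  ZMod p → Matrix (Fin m) (Fin n) F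

/-- The block-circulant matrix of a tensor: block (i,j) is slice (i - j mod p). -/
def bcirc {F : Type*} {m n p : ℕ} (A : Tensor F m n p) :
    Matrix (ZMod p × Fin m) (ZMod p × Fin n) F :=
  Matrix.of fun ir jc => A (ir.1 - jc.1) ir.2 jc.2

/-- The t-product of tensors: (A*B)^{(i)} = ∑_j A^{(i-j)} B^{(j)}. -/
def tpr {F : Type*} [CommRing F] {m n l p : ℕ} [NeZero p]
    (A : Tensor F m n p) (B : Tensor F n l p) : Tensor F m l p :=
  fun i => ∑ j : ZMod p, A (i - j) * B j

/-- The identity tensor: first frontal slice is I_n, others are zero. -/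
def tId (F : Type*) [CommRing F] (n p : ℕ) [NeZero p] : Tensor F n n p :=
  fun i => if i = 0 then 1 else 0

/-- Tensor transpose: transpose each slice and reverse the order of slices 2..p. -/
def tT {F : Type*} {m n p : ℕ} (A : Tensor F m n p) : Tensor F n m p :=
  fun i => (A (-i))ᵀ

/-- ξ = e^{-2πi/p}. -/
noncomputable def xi (p : ℕ) : ℂ :=
  Complex.exp (-(2 * Real.pi * Complex.I) / p)

/-- The normalized DFT matrix of order p. -/
noncomputable def Fmat (p : ℕ) : Matrix (ZMod p) (ZMod p) ℂ :=
  Matrix.of fun j k => (1 / (Real.sqrt p : ℂ)) * xi p ^ (j.val * k.val)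

/-- The Fourier blocks of a complex tensor: A_i = ∑_k ξ^{(i)(k)} A^{(k)} (0-based). -/
noncomputable def fblock {m n p : ℕ} [NeZero p] (A : Tensor ℂ m n p) (i : ZMod p) :
    Matrix (Fin m) (Fin n) ℂ :=
  ∑ k : ZMod p, xi p ^ (i.val * k.val) • A k

/-- Complexification of a real tensor. -/
def cplx {m n p : ℕ} (A : Tensor ℝ m n p) : Tensor ℂ m n p :=
  fun i => (A i).map (Complex.ofReal)

/-- Block diagonal matrix with p equal-size blocks. -/
def blockDiag {m n p : ℕ} (M : ZMod p → Matrix (Fin m) (Fin n) ℂ) :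
    Matrix (ZMod p × Fin m) (ZMod p × Fin n) ℂ :=
  Matrix.of fun ir jc => if ir.1 = jc.1 then M ir.1 ir.2 jc.2 else 0

/-- Entrywise conjugation of a complex matrix. -/
def conjM {m n : ℕ} (M : Matrix (Fin m) (Fin n) ℂ) : Matrix (Fin m) (Fin n) ℂ :=
  M.map (starRingEnd ℂ)

/-- A complex matrix is real if all entries have zero imaginary part. -/
def IsRealM {m n : ℕ} (M : Matrix (Fin m) (Fin n) ℂ) : Prop :=
  ∀ r c, (M r c).im = 0

open Polynomial in
noncomputable def Sq {F : Type*} [Field F] (f : F[X]) (hd : 0 < f.natDegree) : Polynomial.Sequence F where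
  elems' j := X ^ (j % f.natDegree) * f ^ (j / f.natDegree)
  degree_eq' j := by
    have : f ≠ 0 := by rintro rfl; simp at hd
    rw [degree_mul, degree_X_pow, degree_pow, degree_eq_natDegree this]
    have := Nat.mod_add_div j f.natDegree
    rw [mul_comm] at this
    rw [nsmul_eq_mul]
    exact_mod_cast this

open Polynomial in
theorem Sq_apply {F : Type*} [Field F] (f : F[X]) (hd : 0 < f.natDegree) (j : ℕ) :
    Sq f hd j = X ^ (j % f.natDegree) * f ^ (j / f.natDegree) := rfl

open Polynomial in
theorem Sq_X {F : Type*} [Field F] (f : F[X]) (hd : 0 < f.natDegree) (h2 : f.natDegree ≤ 2) (j : ℕ) :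
    X * Sq f hd j ∈ Submodule.span F (Sq f hd '' {k | k ≤ j+1 ∧ j / f.natDegree ≤ k / f.natDegree}) := by
  have key : ∀ k, k ≤ j+1 ∧ j / f.natDegree ≤ k / f.natDegree → ∀ a : F, C a * Sq f hd k ∈ Submodule.span F (Sq f hd '' {k | k ≤ j+1 ∧ j / f.natDegree ≤ k / f.natDegree}) := by
    intro k hk a
    rw [← smul_eq_C_mul]
    exact Submodule.smul_mem _ _ (Submodule.subset_span ⟨k, hk, rfl⟩)
  obtain h | h : f.natDegree = 1 ∨ f.natDegree = 2 := by omega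
  · rw [h] at key ⊢
    have hf := Polynomial.eq_X_add_C_of_natDegree_le_one h.le
    have hc : f.coeff 1 ≠ 0 := by
      have := Polynomial.leadingCoeff_ne_zero.2 (show f ≠ 0 by rintro rfl; simp at hd)
      rwa [leadingCoeff, h] at this
    set a := f.coeff 1
    set b := f.coeff 0
    have e : X * Sq f hd j = C (a⁻¹) * Sq f hd (j+1) + C (-(a⁻¹ * b)) * Sq f hd j := by
      simp only [Sq_apply, h, Nat.mod_one, Nat.div_one, pow_zero, one_mul, pow_succ]
      have hx : (X : F[X]) = C a⁻¹ * f - C (a⁻¹ * b) := by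
        rw [hf, mul_add, ← mul_assoc, ← C_mul, ← C_mul, inv_mul_cancel₀ hc]; simp
      conv_lhs => rw [hx]
      rw [C_neg]; ring
    rw [e]
    exact add_mem (key _ (by simp) _) (key _ (by simp) _)
  · rw [h] at key ⊢
    have hf := Polynomial.eq_quadratic_of_degree_le_two (natDegree_le_iff_degree_le.1 h.le)
    have hc : f.coeff 2 ≠ 0 := by
      have := Polynomial.leadingCoeff_ne_zero.2 (show f ≠ 0 by rintro rfl; simp at hd)
      rwa [leadingCoeff, h] at this
    set a := f.coeff 2
    set b := f.coeff 1
    set c := f.coeff 0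
    obtain ⟨k, rfl | rfl⟩ := Nat.even_or_odd' j
    · have e : X * Sq f hd (2*k) = C 1 * Sq f hd (2*k+1) := by
        simp only [Sq_apply, h]
        rw [show 2*k%2 = 0 by omega, show (2*k+1)%2=1 by omega, show 2*k/2 = k by omega, show (2*k+1)/2=k by omega]
        simp
      rw [e]; exact key _ (by omega) _
    · have e : X * Sq f hd (2*k+1) = C (a⁻¹) * Sq f hd (2*k+2) + C (-(a⁻¹ * b)) * Sq f hd (2*k+1) + C (-(a⁻¹ * c)) * Sq f hd (2*k) := by
        simp only [Sq_apply, h]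
        rw [show 2*k%2 = 0 by omega, show (2*k+1)%2=1 by omega, show 2*k/2 = k by omega, show (2*k+1)/2=k by omega, show (2*k+2)%2=0 by omega, show (2*k+2)/2=k+1 by omega]
        have hx : (X : F[X])^2 = C a⁻¹ * f - C (a⁻¹ * b) * X - C (a⁻¹ * c) := by
          rw [hf, mul_add, mul_add, ← mul_assoc, ← C_mul, ← mul_assoc, ← C_mul, ← C_mul, inv_mul_cancel₀ hc]; simp; ring
        rw [pow_one, ← mul_assoc, ← sq, hx]
        rw [C_neg, C_neg]; ring
      rw [e]
      exact add_mem (add_mem (key _ (by omega) _) (key _ (by omega) _)) (key _ (by omega) _)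

open Polynomial in
theorem cyc {F : Type*} [Field F] (f : F[X]) (hd : 0 < f.natDegree) (h2 : f.natDegree ≤ 2) (e : ℕ) :
    ∃ b : Module.Basis (Fin (f.natDegree * e)) F (F[X] ⧸ (Submodule.span F[X] {f ^ e})),
      ∀ j k, b.repr ((X : F[X]) • b j) k ≠ 0 →
        (k : ℕ) ≤ j + 1 ∧ (j : ℕ) / f.natDegree ≤ (k : ℕ) / f.natDegree := by
  have hf0 : f ≠ 0 := by rintro rfl; simp at hd
  set W := F[X] ⧸ (Submodule.span F[X] {f ^ e}) with hW
  let π : F[X] →ₗ[F[X]] W := Submodule.mkQ _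
  let v : Fin (f.natDegree * e) → W := fun j => π (Sq f hd j)
  have hli : LinearIndependent F v := by
    rw [Fintype.linearIndependent_iff]
    intro g hg
    have h1 : π (∑ i, g i • Sq f hd i) = 0 := by
      rw [map_sum, ← hg]
      refine Finset.sum_congr rfl fun i _ => ?_
      exact LinearMap.map_smul_of_tower π _ _
    rw [Submodule.mkQ_apply, Submodule.Quotient.mk_eq_zero, Submodule.mem_span_singleton] at h1
    obtain ⟨q, hq⟩ := h1
    have h3 : ∑ i, g i • Sq f hd i = 0 := by
      apply Polynomial.eq_zero_of_dvd_of_degree_lt (p := f ^ e) ⟨q, by rw [← hq]; simp [mul_comm]⟩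
      rw [degree_eq_natDegree (pow_ne_zero _ hf0), natDegree_pow]
      refine lt_of_le_of_lt (degree_sum_le _ _) ?_
      rw [Finset.sup_lt_iff (by exact WithBot.bot_lt_coe _)]
      intro i _
      refine lt_of_le_of_lt (degree_smul_le _ _) ?_
      rw [(Sq f hd).degree_eq]
      have := i.2
      exact_mod_cast (this.trans_eq (mul_comm _ _))
    have := (Fintype.linearIndependent_iff.1 ((Sq f hd).linearIndependent.comp (fun i : Fin (f.natDegree * e) => (i : ℕ)) Fin.val_injective)) g h3
    exact this
  have hfin : Module.finrank F W = f.natDegree * e := by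
    have := finrank_quotient_span_eq_natDegree (f := f ^ e)
    rw [natDegree_pow, mul_comm] at this
    exact this
  rcases Nat.eq_zero_or_pos e with he | he
  · subst he
    have : IsEmpty (Fin (f.natDegree * 0)) := by rw [mul_zero]; infer_instance
    have : Subsingleton W := by
      rw [hW]
      exact Submodule.Quotient.subsingleton_iff.2 (by rw [pow_zero]; exact Ideal.span_singleton_one)
    exact ⟨Module.Basis.empty _, fun j => isEmptyElim j⟩
  have : Nonempty (Fin (f.natDegree * e)) := ⟨⟨0, by positivity⟩⟩
  let b := basisOfLinearIndependentOfCardEqFinrank hli (by rw [hfin]; simp)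
  have hb : ∀ j, b j = π (Sq f hd j) := fun j => by simp [b, v]
  refine ⟨b, fun j k hk => ?_⟩
  have hm : (X : F[X]) • b j ∈ Submodule.span F (b '' {k | (k : ℕ) ≤ j + 1 ∧ (j : ℕ) / f.natDegree ≤ (k : ℕ) / f.natDegree}) := by
    rw [hb, ← map_smul]
    have h := Submodule.mem_map_of_mem (f := π.restrictScalars F) (Sq_X f hd h2 j)
    rw [Submodule.map_span] at h
    refine (Submodule.span_le.2 ?_) h
    rintro _ ⟨_, ⟨k, hk, rfl⟩, rfl⟩
    by_cases hke : k < f.natDegree * e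
    · exact Submodule.subset_span ⟨⟨k, hke⟩, hk, hb _⟩
    · have : (π.restrictScalars F) (Sq f hd k) = 0 := by
        change π _ = 0
        rw [Submodule.mkQ_apply, Submodule.Quotient.mk_eq_zero, Submodule.mem_span_singleton]
        have : e ≤ k / f.natDegree := by
          rw [Nat.le_div_iff_mul_le hd, mul_comm]; omega
        obtain ⟨q, hq⟩ := pow_dvd_pow f this
        exact ⟨X ^ (k % f.natDegree) * q, by rw [Sq_apply, hq, smul_eq_mul]; ring⟩
      rw [this]; exact zero_mem _
  rw [Module.Basis.mem_span_image] at hm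
  exact hm (by simpa using hk)

theorem comb {ι : Type*} [Fintype ι] (d e : ι → ℕ) (h1 : ∀ i, 0 < d i) (h2 : ∀ i, d i ≤ 2) :
    ∃ (N : ℕ) (pos : (Σ i, Fin (d i * e i)) ≃ Fin N) (off : ι → ℕ),
      (∀ s, (pos s : ℕ) = off s.1 + s.2) ∧ ∀ i, d i = 2 → Even (off i) := by
  classical
  let τ := (Fintype.equivFin ι).symm
  let g : Fin (Fintype.card ι) → ℕ := fun a => 2 - d (τ a)
  let σ : Fin (Fintype.card ι) ≃ ι := (Tuple.sort g).trans τ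
  have hσ : ∀ a b, a ≤ b → d (σ b) = 2 → d (σ a) = 2 := by
    intro a b hab hb
    have := Tuple.monotone_sort g hab
    have e1 : g (Tuple.sort g a) = 2 - d (σ a) := rfl
    have e2 : g (Tuple.sort g b) = 2 - d (σ b) := rfl
    simp only [Function.comp_apply, e1, e2] at this
    have := h1 (σ a); have := h2 (σ a)
    omega
  let n : Fin (Fintype.card ι) → ℕ := fun a => d (σ a) * e (σ a)
  let E : (Σ a, Fin (n a)) ≃ (Σ i, Fin (d i * e i)) :=
    Equiv.sigmaCongrLeft (β := fun i => Fin (d i * e i)) σ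
  let O : Fin (Fintype.card ι) → ℕ := fun a => ∑ i : Fin a, n (Fin.castLE a.2.le i)
  refine ⟨_, E.symm.trans finSigmaFinEquiv, fun i => O (σ.symm i), ?_, ?_⟩
  · intro s
    obtain ⟨⟨a, k⟩, rfl⟩ := E.surjective s
    rw [Equiv.trans_apply, Equiv.symm_apply_apply, finSigmaFinEquiv_apply]
    have : E ⟨a, k⟩ = ⟨σ a, k⟩ := rfl
    rw [this]
    simp [O]
  · intro i hi
    apply Finset.even_sum
    intro j _
    simp only [n]
    rw [hσ _ (σ.symm i) (by rw [Fin.le_def]; exact j.2.le) (by simpa using hi)]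
    simp

open Polynomial in
theorem field_basis {F : Type*} [Field F] (hF : ∀ f : F[X], Irreducible f → f.natDegree ≤ 2)
    {n : ℕ} (T : (Fin n → F) →ₗ[F] (Fin n → F)) :
    ∃ b : Module.Basis (Fin n) F (Fin n → F), ∀ c r : Fin n,
      b.repr (T (b c)) r ≠ 0 → (r : ℕ) / 2 = c / 2 ∨ (r : ℕ) / 2 = c / 2 + 1 := by
  classical
  obtain ⟨ι, _, p, hp, e, ⟨φ⟩⟩ := Module.equiv_directSum_of_isTorsion
    (R := F[X]) (M := Module.AEval' T)
    (Module.AEval.isTorsion_of_finiteDimensional _ _ _)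
  have hd : ∀ i, 0 < (p i).natDegree := fun i => (hp i).natDegree_pos
  have h2 : ∀ i, (p i).natDegree ≤ 2 := fun i => hF _ (hp i)
  choose b hb using fun i => cyc (p i) (hd i) (h2 i) (e i)
  let φ' := φ.trans (DirectSum.linearEquivFunOnFintype F[X] ι (fun i => F[X] ⧸ Submodule.span F[X] {p i ^ e i}))
  let ψ : (Fin n → F) ≃ₗ[F] (∀ i, F[X] ⧸ Submodule.span F[X] {p i ^ e i}) :=
    (Module.AEval'.of T).trans (φ'.restrictScalars F)
  have hψ : ∀ v, ψ (T v) = (X : F[X]) • ψ v := by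
    intro v
    change φ' (Module.AEval'.of T (T v)) = (X : F[X]) • φ' (Module.AEval'.of T v)
    rw [← map_smul, Module.AEval'.X_smul_of]
  let bV := (Pi.basis b).map ψ.symm
  have hbV : ∀ s t, bV.repr (T (bV s)) t ≠ 0 → ∃ h : t.1 = s.1,
      (t.2 : ℕ) ≤ s.2 + 1 ∧ (s.2 : ℕ) / (p s.1).natDegree ≤ (t.2 : ℕ) / (p s.1).natDegree := by
    rintro ⟨i, j⟩ ⟨i', k⟩ h
    have e1 : bV.repr (T (bV ⟨i, j⟩)) ⟨i', k⟩ =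
        (b i').repr ((X : F[X]) • (Pi.single i (b i j) : ∀ i, F[X] ⧸ Submodule.span F[X] {p i ^ e i}) i') k := by
      simp only [bV, Module.Basis.map_repr, LinearEquiv.trans_apply, Module.Basis.map_apply, LinearEquiv.symm_symm, hψ,
        LinearEquiv.apply_symm_apply, Pi.basis_repr, Pi.basis_apply, Pi.smul_apply]
    rw [e1] at h
    by_cases hi : i' = i
    · subst hi
      rw [Pi.single_eq_same] at h
      exact ⟨rfl, hb _ _ _ h⟩
    · rw [Pi.single_eq_of_ne hi] at h
      simp at h
  obtain ⟨N, pos, off, hpos, hoff⟩ := comb (fun i => (p i).natDegree) e hd h2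
  let B := bV.reindex pos
  have hN : N = n := by
    have := Module.finrank_eq_card_basis B
    simpa using this.symm
  subst hN
  refine ⟨B, fun c r h => ?_⟩
  obtain ⟨s, rfl⟩ := pos.surjective c
  obtain ⟨t, rfl⟩ := pos.surjective r
  have h' : bV.repr (T (bV s)) t ≠ 0 := by
    simpa [B] using h
  obtain ⟨hts, h3, h4⟩ := hbV s t h'
  rw [hpos, hpos, congrArg off hts]
  generalize (t.2 : ℕ) = tt at *
  generalize (s.2 : ℕ) = ss at *
  have := hd s.1
  have := h2 s.1
  have h5 := hoff s.1
  obtain h | h : (p s.1).natDegree = 1 ∨ (p s.1).natDegree = 2 := by omega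
  · rw [h] at h4
    simp only [Nat.div_one] at h4
    omega
  · obtain ⟨q, hq⟩ := h5 h
    rw [h] at h4
    omega

open Polynomial in
theorem field_mat {F : Type*} [Field F] (hF : ∀ f : F[X], Irreducible f → f.natDegree ≤ 2)
    {n : ℕ} (M : Matrix (Fin n) (Fin n) F) :
    ∃ P Q J : Matrix (Fin n) (Fin n) F, P * Q = 1 ∧ Q * P = 1 ∧
      (∀ r c : Fin n, J r c ≠ 0 → (c : ℕ) / 2 = r / 2 ∨ (c : ℕ) / 2 = r / 2 + 1) ∧
      M = P * (J * Q) := by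
  classical
  obtain ⟨b, hb⟩ := field_basis hF (Matrix.toLin' Mᵀ)
  let s := Pi.basisFun F (Fin n)
  let L := LinearMap.toMatrix b b (Matrix.toLin' Mᵀ)
  refine ⟨(b.toMatrix s)ᵀ, (s.toMatrix b)ᵀ, Lᵀ, ?_, ?_, ?_, ?_⟩
  · rw [← Matrix.transpose_mul, Module.Basis.toMatrix_mul_toMatrix_flip, Matrix.transpose_one]
  · rw [← Matrix.transpose_mul, Module.Basis.toMatrix_mul_toMatrix_flip, Matrix.transpose_one]
  · intro r c h
    apply hb
    simpa [L, LinearMap.toMatrix_apply] using h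
  · rw [← Matrix.transpose_mul, ← Matrix.transpose_mul]
    apply Matrix.transpose_injective
    rw [Matrix.transpose_transpose, basis_toMatrix_mul_linearMap_toMatrix_mul_basis_toMatrix]
    exact (LinearMap.toMatrix'_toLin' Mᵀ).symm

open Polynomial in
theorem irr_deg {K : Type*} [Field K] [Algebra ℝ K] [Module.Finite ℝ K] (f : K[X])
    (hf : Irreducible f) : f.natDegree ≤ 2 := by
  have : Fact (Irreducible f) := ⟨hf⟩
  have hfin : Module.Finite K (AdjoinRoot f) := (AdjoinRoot.powerBasis hf.ne_zero).finite
  have : Module.Finite ℝ (AdjoinRoot f) := Module.Finite.trans K _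
  let g : AdjoinRoot f →ₐ[ℝ] ℂ := IsAlgClosed.lift
  have h1 := LinearMap.finrank_le_finrank_of_injective (f := g.toLinearMap) g.toRingHom.injective
  rw [Complex.finrank_real_complex, ← Module.finrank_mul_finrank ℝ K (AdjoinRoot f),
    (AdjoinRoot.powerBasis hf.ne_zero).finrank, AdjoinRoot.powerBasis_dim] at h1
  have : 0 < Module.finrank ℝ K := Module.finrank_pos
  nlinarith

theorem ring_mat {R : Type*} [CommRing R] [Algebra ℝ R] [Module.Finite ℝ R] [IsSemisimpleRing R]
    {n : ℕ} (M : Matrix (Fin n) (Fin n) R) :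
    ∃ P Q J : Matrix (Fin n) (Fin n) R, P * Q = 1 ∧ Q * P = 1 ∧
      (∀ r c : Fin n, J r c ≠ 0 → (c : ℕ) / 2 = r / 2 ∨ (c : ℕ) / 2 = r / 2 + 1) ∧
      M = P * (J * Q) := by
  have key : ∀ I : MaximalSpectrum R, ∃ P Q J : Matrix (Fin n) (Fin n) (R ⧸ I.asIdeal),
      P * Q = 1 ∧ Q * P = 1 ∧
      (∀ r c : Fin n, J r c ≠ 0 → (c : ℕ) / 2 = r / 2 ∨ (c : ℕ) / 2 = r / 2 + 1) ∧
      M.map (Ideal.Quotient.mk I.asIdeal) = P * (J * Q) := by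
    intro I
    have := I.isMaximal
    let _ : Field (R ⧸ I.asIdeal) := Ideal.Quotient.field _
    exact field_mat (fun f hf => irr_deg f hf) _
  choose P Q J h1 h2 h3 h4 using key
  let E := IsArtinianRing.equivPi R
  let G : (∀ I : MaximalSpectrum R, Matrix (Fin n) (Fin n) (R ⧸ I.asIdeal)) →
    Matrix (Fin n) (Fin n) R := fun A => Matrix.of fun r c => E.symm (fun I => A I r c)
  have hE : ∀ x I, E x I = Ideal.Quotient.mk I.asIdeal x := fun x I => rfl
  have hG : ∀ A I, (G A).map (Ideal.Quotient.mk I.asIdeal) = A I := by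
    intro A I
    ext r c
    rw [Matrix.map_apply, ← hE]
    simp [G]
  have hext : ∀ A B : Matrix (Fin n) (Fin n) R, (∀ I : MaximalSpectrum R,
      A.map (Ideal.Quotient.mk I.asIdeal) = B.map (Ideal.Quotient.mk I.asIdeal)) → A = B := by
    intro A B h
    ext r c
    apply E.injective
    funext I
    exact congrFun (congrFun (h I) r) c
  refine ⟨G P, G Q, G J, ?_, ?_, ?_, ?_⟩
  · apply hext; intro I
    rw [Matrix.map_mul, hG, hG, h1, Matrix.map_one _ (map_zero _) (map_one _)]
  · apply hext; intro I
    rw [Matrix.map_mul, hG, hG, h2, Matrix.map_one _ (map_zero _) (map_one _)]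
  · intro r c h
    by_contra hc
    apply h
    apply E.injective
    funext I
    rw [hE, map_zero]
    have := congrFun (congrFun (hG J I) r) c
    rw [Matrix.map_apply] at this
    rw [this]
    by_contra h0
    exact hc (h3 I r c h0)
  · apply hext; intro I
    rw [Matrix.map_mul, Matrix.map_mul, hG, hG, hG, h4]

noncomputable def toAlg {n p : ℕ} [NeZero p] (A : Tensor ℝ n n p) :
    Matrix (Fin n) (Fin n) (AddMonoidAlgebra ℝ (ZMod p)) :=
  Matrix.of fun r c => ⟨Finsupp.equivFunOnFinite.symm fun i => A i r c⟩

noncomputable def ofAlg {n p : ℕ} (M : Matrix (Fin n) (Fin n) (AddMonoidAlgebra ℝ (ZMod p))) :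
    Tensor ℝ n n p := fun i => Matrix.of fun r c => (M r c).coeff i

theorem ofAlg_toAlg {n p : ℕ} [NeZero p] (A : Tensor ℝ n n p) : ofAlg (toAlg A) = A := by
  ext i r c; simp [ofAlg, toAlg]

theorem ofAlg_one {n p : ℕ} [NeZero p] :
    ofAlg (1 : Matrix (Fin n) (Fin n) (AddMonoidAlgebra ℝ (ZMod p))) = tId ℝ n p := by
  ext i r c
  by_cases h : r = c <;> by_cases hi : i = 0 <;>
    simp [ofAlg, tId, Matrix.one_apply, h, hi, AddMonoidAlgebra.one_def, Finsupp.single_apply, eq_comm]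

theorem ofAlg_mul {n p : ℕ} [NeZero p] (A B : Matrix (Fin n) (Fin n) (AddMonoidAlgebra ℝ (ZMod p))) :
    ofAlg (A * B) = tpr (ofAlg A) (ofAlg B) := by
  ext i r c
  simp only [ofAlg, tpr, Matrix.of_apply, Matrix.sum_apply, Matrix.mul_apply,
    AddMonoidAlgebra.coeff_sum, Finsupp.finsetSum_apply]
  rw [Finset.sum_comm]
  refine Finset.sum_congr rfl fun s _ => ?_
  rw [AddMonoidAlgebra.coeff_mul_apply_right, Finsupp.sum_fintype _ _ (by simp)]
  simp [sub_eq_add_neg]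

theorem stmt9 {n p : ℕ} [NeZero p] (A : Tensor ℝ n n p) :
    ∃ P Pinv J : Tensor ℝ n n p,
      tpr P Pinv = tId ℝ n p ∧ tpr Pinv P = tId ℝ n p ∧
      (∃ blk : Fin n → ℕ, Monotone blk ∧
        (∀ j : ℕ, (Finset.univ.filter fun r : Fin n => blk r = j).card ≤ 2) ∧
        (∀ i, ∀ r c : Fin n, (blk c < blk r ∨ blk r + 1 < blk c) → J i r c = 0)) ∧
      A = tpr P (tpr J Pinv) := by
  have : NeZero (Nat.card (ZMod p) : ℝ) := by
    simpa using (⟨Nat.cast_ne_zero.2 (NeZero.ne p)⟩ : NeZero (p : ℝ))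
  obtain ⟨P, Q, J, h1, h2, h3, h4⟩ := ring_mat (toAlg A)
  refine ⟨ofAlg P, ofAlg Q, ofAlg J, ?_, ?_, ⟨fun r => (r : ℕ) / 2, ?_, ?_, ?_⟩, ?_⟩
  · rw [← ofAlg_mul, h1, ofAlg_one]
  · rw [← ofAlg_mul, h2, ofAlg_one]
  · intro a b h
    exact Nat.div_le_div_right h
  · intro j
    have hc : (Finset.univ.filter fun r : Fin n => (r : ℕ) / 2 = j).card ≤
        ({2 * j, 2 * j + 1} : Finset ℕ).card := by
      apply Finset.card_le_card_of_injOn (fun r : Fin n => (r : ℕ))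
      · intro r hr
        simp at hr ⊢
        omega
      · exact Fin.val_injective.injOn
    exact hc.trans Finset.card_le_two
  · intro i r c h
    have : J r c = 0 := by
      by_contra h0
      have := h3 r c h0
      simp only at h
      omega
    simp [ofAlg, this]
  · rw [← ofAlg_mul, ← ofAlg_mul, ← h4, ofAlg_toAlg]
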